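/- arXiv:1001.3270 — 3 statements merged into one kernel-verified Lean document; each statement's English description precedes it below -/
import Mathlib

section
/- Let (M,≪) be a chronological set, M̄ an admissible completion as a point set, and τ a topology on M̄ satisfying the admissibility condition (A1). Then τ satisfies (A2) if and only if it satisfies: (*) whenever a sequence ((P_n,F_n)) in M̄ τ-converges to a pair (P,∅), then P ∈ L̂(P_n) (i.e. P ⊆ LI(P_n) and P is a maximal IP contained in LS(P_n)), and dually, whenever it τ-converges to (∅,F), then F ∈ Ľ(F_n). -/
open Filter Set Topology

variable {M : Type*}

/-- The chronological past `I⁻(p)` of a point. -/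
def IPast (r : M → M → Prop) (p : M) : Set M := {q | r q p}

/-- The chronological future `I⁺(p)` of a point. -/
def IFut (r : M → M → Prop) (p : M) : Set M := {q | r p q}

/-- The chronological past `I⁻[S]` of a set. -/
def IPastS (r : M → M → Prop) (S : Set M) : Set M := ⋃ s ∈ S, IPast r s

/-- The chronological future `I⁺[S]` of a set. -/
def IFutS (r : M → M → Prop) (S : Set M) : Set M := ⋃ s ∈ S, IFut r s

/-- A past set: `P = I⁻[P]`. -/
def IsPastSet (r : M → M → Prop) (P : Set M) : Prop := P = IPastS r P

/-- A future set: `F = I⁺[F]`. -/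
def IsFutSet (r : M → M → Prop) (F : Set M) : Prop := F = IFutS r F

/-- An indecomposable past set (IP). -/
def IsIP (r : M → M → Prop) (P : Set M) : Prop :=
  P.Nonempty ∧ IsPastSet r P ∧
    ¬∃ P₁ P₂ : Set M, IsPastSet r P₁ ∧ IsPastSet r P₂ ∧ P₁ ⊂ P ∧ P₂ ⊂ P ∧ P = P₁ ∪ P₂

/-- An indecomposable future set (IF). -/
def IsIF (r : M → M → Prop) (F : Set M) : Prop :=
  F.Nonempty ∧ IsFutSet r F ∧
    ¬∃ F₁ F₂ : Set M, IsFutSet r F₁ ∧ IsFutSet r F₂ ∧ F₁ ⊂ F ∧ F₂ ⊂ F ∧ F = F₁ ∪ F₂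

/-- A terminal IP (TIP): an IP which is not of the form `I⁻(p)`. -/
def IsTIP (r : M → M → Prop) (P : Set M) : Prop := IsIP r P ∧ ∀ p : M, P ≠ IPast r p

/-- A terminal IF (TIF). -/
def IsTIF (r : M → M → Prop) (F : Set M) : Prop := IsIF r F ∧ ∀ p : M, F ≠ IFut r p

/-- The common future `↑P`. -/
def commonFut (r : M → M → Prop) (P : Set M) : Set M := IFutS r {q | ∀ p ∈ P, r p q}

/-- The common past `↓F`. -/
def commonPast (r : M → M → Prop) (F : Set M) : Set M := IPastS r {q | ∀ p ∈ F, r q p}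

/-- `P` is a maximal IP contained in `S`. -/
def MaxIPIn (r : M → M → Prop) (P S : Set M) : Prop :=
  IsIP r P ∧ P ⊆ S ∧ ∀ P', IsIP r P' → P' ⊆ S → P ⊆ P' → P = P'

/-- `F` is a maximal IF contained in `S`. -/
def MaxIFIn (r : M → M → Prop) (F S : Set M) : Prop :=
  IsIF r F ∧ F ⊆ S ∧ ∀ F', IsIF r F' → F' ⊆ S → F ⊆ F' → F = F'

/-- The Szabados relation between (nonempty) indecomposable sets: `F` is a maximal IF
contained in `↑P` and `P` is a maximal IP contained in `↓F`. -/
def SRelNE (r : M → M → Prop) (P F : Set M) : Prop :=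
  MaxIFIn r F (commonFut r P) ∧ MaxIPIn r P (commonPast r F)

/-- The full S-relation, allowing one empty component. -/
def SRel (r : M → M → Prop) (P F : Set M) : Prop :=
  SRelNE r P F ∨
    (F = ∅ ∧ IsIP r P ∧ ∀ F', IsIF r F' → ¬SRelNE r P F') ∨
    (P = ∅ ∧ IsIF r F ∧ ∀ P', IsIP r P' → ¬SRelNE r P' F)

/-- The embedding `i(p) = (I⁻(p), I⁺(p))`. -/
def chrEmb (r : M → M → Prop) (p : M) : Set M × Set M := (IPast r p, IFut r p)

/-- The image `i(M)` inside the set of pairs. -/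
def imgM (r : M → M → Prop) : Set (Set M × Set M) := Set.range (chrEmb r)

/-- An admissible completion as a point set. -/
structure IsAdmissibleCompletion (r : M → M → Prop) (Mb : Set (Set M × Set M)) : Prop where
  mem_point : ∀ p : M, chrEmb r p ∈ Mb
  complete_TIP : ∀ P : Set M, IsTIP r P → ∃ x ∈ Mb \ imgM r, x.1 = P
  complete_TIF : ∀ F : Set M, IsTIF r F → ∃ x ∈ Mb \ imgM r, x.2 = F
  srel : ∀ x ∈ Mb, SRel r x.1 x.2

/-- The extended chronological relation `(P,F) ≪̄ (P',F') ↔ F ∩ P' ≠ ∅`. -/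
def extChron (x y : Set M × Set M) : Prop := (x.2 ∩ y.1).Nonempty

/-- A chronology: a transitive and anti-reflexive binary relation. -/
def IsChronology (r : M → M → Prop) : Prop := Transitive r ∧ Irreflexive r

/-- A chronological set: a chronology with no isolates which is chronologically separable. -/
def IsChronologicalSet (r : M → M → Prop) : Prop :=
  IsChronology r ∧ (∀ x, ∃ y, r x y ∨ r y x) ∧
    ∃ S : Set M, S.Countable ∧ ∀ x y, r x y → ∃ s ∈ S, r x s ∧ r s y
/-- The chronological future of a point of the completion, inside the completion,
with respect to the extended chronological relation. -/
def futIn (Mb : Set (Set M × Set M)) (x : ↥Mb) : Set ↥Mb :=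
  {y | extChron (x : Set M × Set M) (y : Set M × Set M)}

/-- The chronological past of a point of the completion, inside the completion. -/
def pastIn (Mb : Set (Set M × Set M)) (x : ↥Mb) : Set ↥Mb :=
  {y | extChron (y : Set M × Set M) (x : Set M × Set M)}

/-- CEAT: the coarsest topology on the completion in which all the sets `I⁺((P,F))`
and `I⁻((P,F))` are open. -/
def CEAT (Mb : Set (Set M × Set M)) : TopologicalSpace ↥Mb :=
  TopologicalSpace.generateFrom
    ({S | ∃ x : ↥Mb, S = futIn Mb x} ∪ {S | ∃ x : ↥Mb, S = pastIn Mb x})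

/-- The set-theoretic inferior limit of a sequence of sets. -/
def setLI (A : ℕ → Set M) : Set M := {x | ∀ᶠ n in Filter.atTop, x ∈ A n}

/-- The set-theoretic superior limit of a sequence of sets. -/
def setLS (A : ℕ → Set M) : Set M := {x | ∃ᶠ n in Filter.atTop, x ∈ A n}

/-- The chronological limit operator (on pairs). -/
def chrLim (r : M → M → Prop) (σ : ℕ → Set M × Set M) (x : Set M × Set M) : Prop :=
  (x.1 ≠ ∅ → x.1 ⊆ setLI (fun n => (σ n).1) ∧ MaxIPIn r x.1 (setLS fun n => (σ n).1)) ∧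
  (x.2 ≠ ∅ → x.2 ⊆ setLI (fun n => (σ n).2) ∧ MaxIFIn r x.2 (setLS fun n => (σ n).2))

/-- The topology derived from a limit operator: closed sets are those containing all the
`L`-limits of their sequences. -/
def derivedTop {X : Type*} (L : (ℕ → X) → Set X)
    (hL : ∀ (σ : ℕ → X) (φ : ℕ → ℕ), StrictMono φ → L σ ⊆ L (σ ∘ φ)) :
    TopologicalSpace X where
  IsOpen U := ∀ σ : ℕ → X, (∀ n, σ n ∈ Uᶜ) → L σ ⊆ Uᶜ
  isOpen_univ := by
    intro σ h
    simpa using h 0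
  isOpen_inter := by
    intro U V hU hV σ hσ x hx
    have h : ∀ n, σ n ∈ Uᶜ ∨ σ n ∈ Vᶜ := by
      intro n
      have h' := hσ n
      rw [Set.compl_inter] at h'
      exact h'
    have hfreq : (∃ᶠ n in Filter.atTop, σ n ∈ Uᶜ) ∨ ∃ᶠ n in Filter.atTop, σ n ∈ Vᶜ :=
      Filter.frequently_or_distrib.mp (Filter.Frequently.of_forall h)
    rw [Set.compl_inter]
    rcases hfreq with hf | hf
    · obtain ⟨φ, hφ, hmem⟩ := Filter.extraction_of_frequently_atTop hf
      exact Or.inl (hU (σ ∘ φ) hmem (hL σ φ hφ hx))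
    · obtain ⟨φ, hφ, hmem⟩ := Filter.extraction_of_frequently_atTop hf
      exact Or.inr (hV (σ ∘ φ) hmem (hL σ φ hφ hx))
  isOpen_sUnion := by
    intro S hS σ hσ x hx
    intro hmem
    rcases hmem with ⟨U, hU, hxU⟩
    exact hS U hU σ (fun n h => hσ n ⟨U, hU, h⟩) hx hxU

lemma setLI_subseq {A : ℕ → Set M} {φ : ℕ → ℕ} (hφ : StrictMono φ) :
    setLI A ⊆ setLI fun n => A (φ n) :=
  fun _ hx => hφ.tendsto_atTop.eventually hx

lemma setLS_subseq {A : ℕ → Set M} {φ : ℕ → ℕ} (hφ : StrictMono φ) :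
    (setLS fun n => A (φ n)) ⊆ setLS A :=
  fun _ hx => hφ.tendsto_atTop.frequently hx

/-- The chronological limit operator on the completion. -/
def chrL (r : M → M → Prop) (Mb : Set (Set M × Set M)) (σ : ℕ → ↥Mb) : Set ↥Mb :=
  {x | chrLim r (fun n => ((σ n : Set M × Set M))) (x : Set M × Set M)}

lemma chrL_subseq (r : M → M → Prop) (Mb : Set (Set M × Set M)) :
    ∀ (σ : ℕ → ↥Mb) (φ : ℕ → ℕ), StrictMono φ → chrL r Mb σ ⊆ chrL r Mb (σ ∘ φ) := by
  intro σ φ hφ x hx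
  obtain ⟨h1, h2⟩ := hx
  constructor
  · intro hne
    obtain ⟨hli, hmax⟩ := h1 hne
    exact ⟨fun y hy => setLI_subseq hφ (hli hy), hmax.1,
      fun y hy => Filter.Eventually.frequently (setLI_subseq hφ (hli hy)),
      fun P' hP' hP'sub hsub => hmax.2.2 P' hP' (fun y hy => setLS_subseq hφ (hP'sub hy)) hsub⟩
  · intro hne
    obtain ⟨hli, hmax⟩ := h2 hne
    exact ⟨fun y hy => setLI_subseq hφ (hli hy), hmax.1,
      fun y hy => Filter.Eventually.frequently (setLI_subseq hφ (hli hy)),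
      fun F' hF' hF'sub hsub => hmax.2.2 F' hF' (fun y hy => setLS_subseq hφ (hF'sub hy)) hsub⟩

/-- The chronological topology on the completion. -/
def chrTop (r : M → M → Prop) (Mb : Set (Set M × Set M)) : TopologicalSpace ↥Mb :=
  derivedTop (chrL r Mb) (chrL_subseq r Mb)

/-- Admissibility condition (A1): chronological futures and pasts are open. -/
def CondA1 (Mb : Set (Set M × Set M)) (τ : TopologicalSpace ↥Mb) : Prop :=
  ∀ x : ↥Mb, IsOpen[τ] (futIn Mb x) ∧ IsOpen[τ] (pastIn Mb x)

/-- Admissibility condition (A2). -/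
def CondA2 (Mb : Set (Set M × Set M)) (τ : TopologicalSpace ↥Mb) : Prop :=
  (∀ (σ : ℕ → ↥Mb) (x : ↥Mb), Filter.Tendsto σ Filter.atTop (@nhds _ τ x) →
      (x : Set M × Set M).2 = ∅ →
      ∀ y : ↥Mb, (x : Set M × Set M).1 ⊆ (y : Set M × Set M).1 →
        (y : Set M × Set M).1 ⊆ setLI (fun n => ((σ n : Set M × Set M)).1) → y = x) ∧
  (∀ (σ : ℕ → ↥Mb) (x : ↥Mb), Filter.Tendsto σ Filter.atTop (@nhds _ τ x) →
      (x : Set M × Set M).1 = ∅ →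
      ∀ y : ↥Mb, (x : Set M × Set M).2 ⊆ (y : Set M × Set M).2 →
        (y : Set M × Set M).2 ⊆ setLI (fun n => ((σ n : Set M × Set M)).2) → y = x)

/-- Admissibility condition (A3): maximal coarseness among (A1)∧(A2) topologies. -/
def CondA3 (Mb : Set (Set M × Set M)) (τ : TopologicalSpace ↥Mb) : Prop :=
  ∀ τ' : TopologicalSpace ↥Mb, CondA1 Mb τ' → CondA2 Mb τ' → ¬(τ < τ')

lemma isPastSet_iff {r : M → M → Prop} {P : Set M} :
    IsPastSet r P ↔ ∀ q, q ∈ P ↔ ∃ p ∈ P, r q p := by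
  simp [IsPastSet, IPastS, IPast, Set.ext_iff]

lemma isPastSet_IPastS {r : M → M → Prop} (htrans : Transitive r)
    (hdense : ∀ x y, r x y → ∃ s, r x s ∧ r s y) (S : Set M) : IsPastSet r (IPastS r S) := by
  rw [isPastSet_iff]
  intro q
  simp only [IPastS, IPast, mem_iUnion, mem_ofPred_eq, exists_prop]
  constructor
  · rintro ⟨s, hs, hqs⟩
    obtain ⟨u, hqu, hus⟩ := hdense q s hqs
    exact ⟨u, ⟨s, hs, hus⟩, hqu⟩
  · rintro ⟨u, ⟨s, hs, hus⟩, hqu⟩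
    exact ⟨s, hs, htrans hqu hus⟩

/-- An indecomposable past set is directed. -/
lemma IsIP.directed {r : M → M → Prop} (htrans : Transitive r)
    (hdense : ∀ x y, r x y → ∃ s, r x s ∧ r s y) {P : Set M} (hP : IsIP r P)
    {a b : M} (ha : a ∈ P) (hb : b ∈ P) : ∃ c ∈ P, r a c ∧ r b c := by
  obtain ⟨-, hpast, hind⟩ := hP
  have hmem := isPastSet_iff.mp hpast
  have hsub : ∀ S ⊆ P, IPastS r S ⊆ P := by
    intro S hS q hq
    simp only [IPastS, IPast, mem_iUnion, mem_ofPred_eq, exists_prop] at hq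
    obtain ⟨s, hs, hqs⟩ := hq
    exact (hmem q).mpr ⟨s, hS hs, hqs⟩
  by_contra hne
  push Not at hne
  refine hind ⟨IPastS r {c ∈ P | r a c}, IPastS r {c ∈ P | ¬ r a c},
    isPastSet_IPastS htrans hdense _, isPastSet_IPastS htrans hdense _,
    ⟨hsub _ (sep_subset _ _), fun h => ?_⟩, ⟨hsub _ (sep_subset _ _), fun h => ?_⟩, ?_⟩
  · have := h hb
    simp only [IPastS, IPast, mem_iUnion, mem_ofPred_eq, exists_prop] at this
    obtain ⟨c, ⟨hc, hac⟩, hbc⟩ := this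
    exact hne c hc hac hbc
  · have := h ha
    simp only [IPastS, IPast, mem_iUnion, mem_ofPred_eq, exists_prop] at this
    obtain ⟨c, ⟨-, hac⟩, hac'⟩ := this
    exact hac hac'
  · refine Subset.antisymm (fun q hq => ?_)
      (union_subset (hsub _ (sep_subset _ _)) (hsub _ (sep_subset _ _)))
    obtain ⟨c, hc, hqc⟩ := (hmem q).mp hq
    simp only [mem_union, IPastS, IPast, mem_iUnion, mem_ofPred_eq, exists_prop]
    by_cases hac : r a c
    · exact Or.inl ⟨c, ⟨hc, hac⟩, hqc⟩
    · exact Or.inr ⟨c, ⟨hc, hac⟩, hqc⟩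

/-- An IP contained in the superior limit of a sequence of past sets is contained in the
inferior limit of a subsequence. -/
lemma IsIP.exists_subseq_subset_setLI {r : M → M → Prop} (htrans : Transitive r)
    (hsep : ∃ S : Set M, S.Countable ∧ ∀ x y, r x y → ∃ s ∈ S, r x s ∧ r s y)
    {P : Set M} (hP : IsIP r P) {A : ℕ → Set M} (hA : ∀ n, IsPastSet r (A n))
    (hPA : P ⊆ setLS A) : ∃ φ : ℕ → ℕ, StrictMono φ ∧ P ⊆ setLI fun n => A (φ n) := by
  obtain ⟨S, hS, hsep⟩ := hsep
  have hdense : ∀ x y, r x y → ∃ s, r x s ∧ r s y := fun x y h =>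
    let ⟨s, _, hs⟩ := hsep x y h
    ⟨s, hs⟩
  have hmem := isPastSet_iff.mp hP.2.1
  have hbetween : ∀ q ∈ P, ∃ s ∈ P ∩ S, r q s := by
    intro q hq
    obtain ⟨p, hp, hqp⟩ := (hmem q).mp hq
    obtain ⟨s, hs, hqs, hsp⟩ := hsep q p hqp
    exact ⟨s, ⟨(hmem s).mpr ⟨p, hp, hsp⟩, hs⟩, hqs⟩
  have hne : (P ∩ S).Nonempty :=
    let ⟨q, hq⟩ := hP.1
    let ⟨s, hs, _⟩ := hbetween q hq
    ⟨s, hs⟩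
  obtain ⟨f, hf⟩ := (hS.mono inter_subset_right).exists_eq_range hne
  have hfP : ∀ k, f k ∈ P := fun k => (hf ▸ mem_range_self k : f k ∈ P ∩ S).1
  have hbound : ∀ k, ∃ u ∈ P, ∀ i ≤ k, r (f i) u := by
    intro k
    induction k with
    | zero =>
      obtain ⟨p, hp, h⟩ := (hmem (f 0)).mp (hfP 0)
      exact ⟨p, hp, fun i hi => by rwa [Nat.le_zero.mp hi]⟩
    | succ k ih =>
      obtain ⟨u, hu, hfu⟩ := ih
      obtain ⟨c, hc, huc, hfc⟩ := hP.directed htrans hdense hu (hfP (k + 1))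
      refine ⟨c, hc, fun i hi => ?_⟩
      rcases Nat.le_succ_iff.mp hi with h | rfl
      · exact htrans (hfu i h) huc
      · exact hfc
  have hfreq : ∀ k, ∃ᶠ n in atTop, ∀ i ≤ k, f i ∈ A n := by
    intro k
    obtain ⟨u, hu, hfu⟩ := hbound k
    exact (hPA hu).mono fun n hn i hi => (isPastSet_iff.mp (hA n) _).mpr ⟨u, hn, hfu i hi⟩
  obtain ⟨φ, hφ, hφA⟩ := extraction_forall_of_frequently hfreq
  refine ⟨φ, hφ, fun q hq => ?_⟩
  obtain ⟨s, hs, hqs⟩ := hbetween q hq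
  rw [hf] at hs
  obtain ⟨i, rfl⟩ := hs
  filter_upwards [eventually_ge_atTop i] with n hn
  exact (isPastSet_iff.mp (hA _) q).mpr ⟨f i, hφA n i hn, hqs⟩

/-- If the sets of points whose past component meets `I⁺(q)` are open, then the past component of
a limit is contained in the inferior limit, and it is a maximal IP in the superior limit as soon
as it is maximal among the IPs in the inferior limits of subsequences. -/
lemma subset_setLI_and_maxIPIn_setLS {r : M → M → Prop} (htrans : Transitive r)
    (hsep : ∃ S : Set M, S.Countable ∧ ∀ x y, r x y → ∃ s ∈ S, r x s ∧ r s y)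
    {X : Type*} [TopologicalSpace X] {A : X → Set M} (hA : ∀ x, IsPastSet r (A x))
    (hopen : ∀ q, IsOpen {y | (IFut r q ∩ A y).Nonempty})
    {σ : ℕ → X} {x : X} (hσ : Tendsto σ atTop (𝓝 x)) (hx : IsIP r (A x))
    (hmax : ∀ φ : ℕ → ℕ, StrictMono φ → ∀ P, IsIP r P → A x ⊆ P →
      (P ⊆ setLI fun n => A (σ (φ n))) → A x = P) :
    (A x ⊆ setLI fun n => A (σ n)) ∧ MaxIPIn r (A x) (setLS fun n => A (σ n)) := by
  have hLI : A x ⊆ setLI fun n => A (σ n) := by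
    intro q hq
    obtain ⟨p, hp, hqp⟩ := (isPastSet_iff.mp (hA x) q).mp hq
    filter_upwards [hσ.eventually ((hopen q).mem_nhds ⟨p, hqp, hp⟩)] with n hn
    obtain ⟨s, hqs, hs⟩ := hn
    exact (isPastSet_iff.mp (hA _) q).mpr ⟨s, hs, hqs⟩
  refine ⟨hLI, hx, fun q hq => (hLI hq).frequently, fun P hP hPLS hxP => ?_⟩
  obtain ⟨φ, hφ, hPLI⟩ := hP.exists_subseq_subset_setLI htrans hsep (fun n => hA (σ n)) hPLS
  exact hmax φ hφ P hP hxP hPLI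

lemma SRel.fst_isIP {r : M → M → Prop} {P F : Set M} (h : SRel r P F) (hP : P.Nonempty) :
    IsIP r P := by
  rcases h with h | ⟨-, h, -⟩ | ⟨rfl, -⟩
  · exact h.2.1
  · exact h
  · exact absurd hP not_nonempty_empty

/-- The S-relation is self-dual. -/
lemma SRel.flip {r : M → M → Prop} {P F : Set M} (h : SRel r P F) : SRel (flip r) F P := by
  rcases h with h | h | h
  · exact Or.inl ⟨h.2, h.1⟩
  · exact Or.inr (Or.inr ⟨h.1, h.2.1, fun F' hF' hs => h.2.2 F' hF' ⟨hs.2, hs.1⟩⟩)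
  · exact Or.inr (Or.inl ⟨h.1, h.2.1, fun P' hP' hs => h.2.2 P' hP' ⟨hs.2, hs.1⟩⟩)

lemma SRel.isPastSet_fst {r : M → M → Prop} {P F : Set M} (h : SRel r P F) : IsPastSet r P := by
  rcases P.eq_empty_or_nonempty with rfl | hP
  · simp [IsPastSet, IPastS]
  · exact (h.fst_isIP hP).2.1

lemma SRel.fst_isIP_of_snd_eq_empty {r : M → M → Prop} {P : Set M} (h : SRel r P ∅) :
    IsIP r P := by
  rcases h with h | ⟨-, h, -⟩ | ⟨-, h, -⟩
  · exact absurd h.1.1.1 not_nonempty_empty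
  · exact h
  · exact absurd h.1 not_nonempty_empty

/-- A past component paired with `∅` is not paired with anything else. -/
lemma SRel.snd_eq_empty {r : M → M → Prop} {P F : Set M} (h : SRel r P ∅) (h' : SRel r P F) :
    F = ∅ := by
  have hP := h.fst_isIP_of_snd_eq_empty
  rcases h' with h' | ⟨h', -⟩ | ⟨rfl, -⟩
  · rcases h with h | ⟨-, -, h⟩ | ⟨-, h, -⟩
    · exact absurd h.1.1.1 not_nonempty_empty
    · exact absurd h' (h F h'.1.1)
    · exact absurd h.1 not_nonempty_empty
  · exact h'
  · exact absurd hP.1 not_nonempty_empty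

lemma IsAdmissibleCompletion.exists_fst_eq {r : M → M → Prop} {Mb : Set (Set M × Set M)}
    (hMb : IsAdmissibleCompletion r Mb) {P : Set M} (hP : IsIP r P) : ∃ y : Mb, y.1.1 = P := by
  by_cases h : ∃ p, P = IPast r p
  · obtain ⟨p, rfl⟩ := h
    exact ⟨⟨_, hMb.mem_point p⟩, rfl⟩
  · push Not at h
    obtain ⟨y, hy, hyP⟩ := hMb.complete_TIP P ⟨hP, h⟩
    exact ⟨⟨y, hy.1⟩, hyP⟩

lemma IsAdmissibleCompletion.exists_snd_eq {r : M → M → Prop} {Mb : Set (Set M × Set M)}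
    (hMb : IsAdmissibleCompletion r Mb) {F : Set M} (hF : IsIF r F) : ∃ y : Mb, y.1.2 = F := by
  by_cases h : ∃ p, F = IFut r p
  · obtain ⟨p, rfl⟩ := h
    exact ⟨⟨_, hMb.mem_point p⟩, rfl⟩
  · push Not at h
    obtain ⟨y, hy, hyF⟩ := hMb.complete_TIF F ⟨hF, h⟩
    exact ⟨⟨y, hy.1⟩, hyF⟩

/-- **Proposition.** Let `(M,≪)` be a chronological set, `M̄` an admissible completion as a
point set and `τ` a topology on `M̄` satisfying (A1). Then `τ` satisfies (A2) iff it satisfies: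
(*) whenever a sequence `((Pₙ,Fₙ))` `τ`-converges to `(P,∅)` then `P ∈ L̂(Pₙ)`, and dually,
whenever it `τ`-converges to `(∅,F)` then `F ∈ Ľ(Fₙ)`. -/
theorem condA2_iff_star
    (r : M → M → Prop) (hchr : IsChronologicalSet r)
    (Mb : Set (Set M × Set M)) (hMb : IsAdmissibleCompletion r Mb)
    (τ : TopologicalSpace ↥Mb) (hA1 : CondA1 Mb τ) :
    CondA2 Mb τ ↔
      ((∀ (σ : ℕ → ↥Mb) (x : ↥Mb), Filter.Tendsto σ Filter.atTop (@nhds _ τ x) →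
          (x : Set M × Set M).2 = ∅ →
          ((x : Set M × Set M).1 ⊆ setLI fun n => ((σ n : Set M × Set M)).1) ∧
            MaxIPIn r (x : Set M × Set M).1 (setLS fun n => ((σ n : Set M × Set M)).1)) ∧
       (∀ (σ : ℕ → ↥Mb) (x : ↥Mb), Filter.Tendsto σ Filter.atTop (@nhds _ τ x) →
          (x : Set M × Set M).1 = ∅ →
          ((x : Set M × Set M).2 ⊆ setLI fun n => ((σ n : Set M × Set M)).2) ∧
            MaxIFIn r (x : Set M × Set M).2 (setLS fun n => ((σ n : Set M × Set M)).2))) := by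
  obtain ⟨⟨htrans, -⟩, -, hsep⟩ := hchr
  have hsep' : ∃ S : Set M, S.Countable ∧
      ∀ x y, flip r x y → ∃ s ∈ S, flip r x s ∧ flip r s y :=
    let ⟨S, hS, h⟩ := hsep
    ⟨S, hS, fun x y hxy => let ⟨s, hs, h₁, h₂⟩ := h y x hxy; ⟨s, hs, h₂, h₁⟩⟩
  have htrans' : Transitive (flip r) := fun _ _ _ hab hbc => htrans hbc hab
  have hrel : ∀ x : Mb, SRel r x.1.1 x.1.2 := fun x => hMb.srel x.1 x.2
  refine ⟨fun h => ⟨fun σ x hσ hx => ?_, fun σ x hσ hx => ?_⟩,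
    fun h => ⟨fun σ x hσ hx y hxy hy => ?_, fun σ x hσ hx y hxy hy => ?_⟩⟩
  · refine subset_setLI_and_maxIPIn_setLS htrans hsep (A := fun y : Mb => y.1.1)
      (fun y => (hrel y).isPastSet_fst) (fun q => (hA1 ⟨_, hMb.mem_point q⟩).1) hσ
      (hx ▸ hrel x).fst_isIP_of_snd_eq_empty fun φ hφ P hP hxP hPLI => ?_
    obtain ⟨y, rfl⟩ := hMb.exists_fst_eq hP
    rw [h.1 (σ ∘ φ) x (hσ.comp hφ.tendsto_atTop) hx y hxP hPLI]
  · refine subset_setLI_and_maxIPIn_setLS htrans' hsep' (A := fun y : Mb => y.1.2)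
      (fun y => (hrel y).flip.isPastSet_fst) (fun q => ?_) hσ
      (hx ▸ (hrel x).flip).fst_isIP_of_snd_eq_empty fun φ hφ F hF hxF hFLI => ?_
    · simp only [inter_comm (IFut _ _)]
      exact (hA1 ⟨_, hMb.mem_point q⟩).2
    · obtain ⟨y, rfl⟩ := hMb.exists_snd_eq hF
      rw [h.2 (σ ∘ φ) x (hσ.comp hφ.tendsto_atTop) hx y hxF hFLI]
  · obtain ⟨-, hIP, -, hmax⟩ := h.1 σ x hσ hx
    have heq := hmax _ ((hrel y).fst_isIP (hIP.1.mono hxy)) (fun q hq => (hy hq).frequently) hxy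
    have hxr := hrel x
    rw [hx, heq] at hxr
    exact Subtype.ext (Prod.ext heq.symm ((hxr.snd_eq_empty (hrel y)).trans hx.symm))
  · obtain ⟨-, hIF, -, hmax⟩ := h.2 σ x hσ hx
    have heq := hmax _ ((hrel y).flip.fst_isIP (hIF.1.mono hxy))
      (fun q hq => (hy hq).frequently) hxy
    have hxr := (hrel x).flip
    rw [hx, heq] at hxr
    exact Subtype.ext (Prod.ext ((hxr.snd_eq_empty (hrel y).flip).trans hx.symm) heq.symm)
end

section
/- Let M̄ be an admissible completion as a point set of (M,≪), endowed with the chr. topology. For every future-directed chain (p_n) in M (p_n ≪ p_{n+1} for all n) and every pair (P,F) ∈ M̄ whose first component satisfies P = I⁻[{p_n : n ∈ ℕ}], one has (P,F) ∈ L(((I⁻(p_n),I⁺(p_n)))_n); in particular, the sequence ((I⁻(p_n),I⁺(p_n)))_n converges to (P,F) in the chr. topology. Dually, for every past-directed chain (q_n) (q_{n+1} ≪ q_n) and every (P,F) ∈ M̄ with F = I⁺[{q_n : n ∈ ℕ}], the sequence ((I⁻(q_n),I⁺(q_n)))_n converges to (P,F). -/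
open Filter Set Topology

variable {M : Type*}

lemma tendsto_derivedTop {X : Type*} {L : (ℕ → X) → Set X}
    {hL : ∀ (σ : ℕ → X) (φ : ℕ → ℕ), StrictMono φ → L σ ⊆ L (σ ∘ φ)}
    {σ : ℕ → X} {x : X} (hx : x ∈ L σ) :
    Tendsto σ atTop (@nhds _ (derivedTop L hL) x) := by
  let _ := derivedTop L hL
  refine tendsto_nhds.2 fun U hU hxU => ?_
  by_contra hfreq
  obtain ⟨φ, hφ, hmem⟩ := extraction_of_frequently_atTop (not_eventually.1 hfreq)
  exact hU (σ ∘ φ) hmem (hL σ φ hφ hx) hxU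

lemma rel_of_lt_of_chain {r : M → M → Prop} (hr : Transitive r) {p : ℕ → M}
    (hp : ∀ n, r (p n) (p (n + 1))) {m n : ℕ} (hmn : m < n) : r (p m) (p n) := by
  induction n, hmn using Nat.le_induction with
  | base => exact hp m
  | succ n _ ih => exact hr ih (hp n)

lemma mem_IPastS_range {r : M → M → Prop} {p : ℕ → M} {y : M} :
    y ∈ IPastS r (range p) ↔ ∃ n, r y (p n) := by
  simp [IPastS, IPast]

/-- Any S-related pair whose first component is generated by a future-directed chain is a
chronological limit of that chain. -/
lemma chrLim_of_chain {r : M → M → Prop} (hr : Transitive r) {p : ℕ → M}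
    (hp : ∀ n, r (p n) (p (n + 1))) {P F : Set M} (hPF : SRel r P F)
    (hP : P = IPastS r (range p)) : chrLim r (fun n => chrEmb r (p n)) (P, F) := by
  have hpP (n : ℕ) : p n ∈ P := hP ▸ mem_IPastS_range.2 ⟨n + 1, hp n⟩
  have hP0 : P ≠ ∅ := Set.Nonempty.ne_empty ⟨_, hpP 0⟩
  constructor
  · intro _
    have hIP : IsIP r P := by
      rcases hPF with h | ⟨_, h, _⟩ | ⟨h, _⟩
      exacts [h.2.1, h, absurd h hP0]
    have hLI : P ⊆ setLI fun n => IPast r (p n) := by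
      intro y hy
      obtain ⟨m, hm⟩ := mem_IPastS_range.1 (hP ▸ hy)
      filter_upwards [eventually_gt_atTop m] with n hn
      exact hr hm (rel_of_lt_of_chain hr hp hn)
    refine ⟨hLI, hIP, fun y hy => (hLI hy).frequently, fun P' _ hP' hPP' =>
      hPP'.antisymm fun y hy => ?_⟩
    obtain ⟨n, hn⟩ := (hP' hy).exists
    exact hP ▸ mem_IPastS_range.2 ⟨n, hn⟩
  · intro hF0
    obtain ⟨hIF, hFsub, hFmax⟩ : MaxIFIn r F (commonFut r P) := by
      rcases hPF with h | ⟨h, _⟩ | ⟨h, _⟩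
      exacts [h.1, absurd h hF0, absurd h hP0]
    have hLI : F ⊆ setLI fun n => IFut r (p n) := by
      intro y hy
      obtain ⟨q, hq, hqy⟩ := mem_iUnion₂.1 (hFsub hy)
      exact Eventually.of_forall fun n => hr (hq _ (hpP n)) hqy
    refine ⟨hLI, hIF, fun y hy => (hLI hy).frequently, fun F' hF' hsub =>
      hFmax F' hF' fun y hy => ?_⟩
    rw [hF'.2.1] at hy
    obtain ⟨z, hz, hzy⟩ := mem_iUnion₂.1 hy
    refine mem_iUnion₂.2 ⟨z, fun a ha => ?_, hzy⟩
    obtain ⟨m, hm⟩ := mem_IPastS_range.1 (hP ▸ ha)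
    obtain ⟨n, hmn, hn⟩ := frequently_atTop.1 (hsub hz) (m + 1)
    exact hr hm (hr (rel_of_lt_of_chain hr hp hmn) hn)

/-- **Lemma.** In an admissible completion as a point set endowed with the chr. topology,
for any future-directed chain `(pₙ)` and any `(P,F) ∈ M̄` with `P = I⁻[{pₙ}]`, one has
`(P,F) ∈ L((i(pₙ)))`, and in particular `(i(pₙ))` converges to `(P,F)`; dually, for any
past-directed chain `(qₙ)` and any `(P,F) ∈ M̄` with `F = I⁺[{qₙ}]`, the sequence `(i(qₙ))`
converges to `(P,F)`. -/
theorem chains_converge_chrTop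
    (r : M → M → Prop) (hr : IsChronology r)
    (Mb : Set (Set M × Set M)) (hMb : IsAdmissibleCompletion r Mb) :
    (∀ p : ℕ → M, (∀ n, r (p n) (p (n + 1))) →
      ∀ x : ↥Mb, (x : Set M × Set M).1 = IPastS r (Set.range p) →
        x ∈ chrL r Mb (fun n => (⟨chrEmb r (p n), hMb.mem_point (p n)⟩ : ↥Mb)) ∧
        Filter.Tendsto (fun n => (⟨chrEmb r (p n), hMb.mem_point (p n)⟩ : ↥Mb))
          Filter.atTop (@nhds _ (chrTop r Mb) x)) ∧
    (∀ q : ℕ → M, (∀ n, r (q (n + 1)) (q n)) →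
      ∀ x : ↥Mb, (x : Set M × Set M).2 = IFutS r (Set.range q) →
        Filter.Tendsto (fun n => (⟨chrEmb r (q n), hMb.mem_point (q n)⟩ : ↥Mb))
          Filter.atTop (@nhds _ (chrTop r Mb) x)) := by
  constructor
  · intro p hp x hx
    have hmem : x ∈ chrL r Mb (fun n => ⟨chrEmb r (p n), hMb.mem_point (p n)⟩) :=
      chrLim_of_chain hr.1 hp (hMb.srel x x.2) hx
    exact ⟨hmem, tendsto_derivedTop hmem⟩
  · intro q hq x hx
    have hflip : Transitive (flip r) := fun _ _ _ hab hbc => hr.1 hbc hab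
    have hlim := chrLim_of_chain hflip hq (hMb.srel x x.2).flip hx
    exact tendsto_derivedTop (show x ∈ chrL r Mb _ from ⟨hlim.2, hlim.1⟩)
end

section
/- Let M be a set endowed with a chronology ≪ and endow M with the Alexandrov topology generated by the sets I⁺(p) ∩ I⁻(q) for p,q ∈ M. Let P be an IP which is the past of a future-directed chain, i.e. P = I⁻[{p_n : n ∈ ℕ}] with p_n ≪ p_{n+1} for all n, and let P' be a past set with P' ⊊ P. Then P \ cl(P') is non-empty, where cl denotes closure in the Alexandrov topology. -/
open Filter Set Topology

variable {M : Type*}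

/-- The Alexandrov topology on a set with a chronology, generated by the sets
`I⁺(p) ∩ I⁻(q)`. -/
def alexTop (r : M → M → Prop) : TopologicalSpace M :=
  TopologicalSpace.generateFrom {S : Set M | ∃ p q : M, S = IFut r p ∩ IPast r q}

theorem IsPastSet.mem_of_rel {r : M → M → Prop} {P : Set M} (hP : IsPastSet r P) {x y : M}
    (hx : x ∈ P) (hyx : r y x) : y ∈ P := by
  rw [hP]
  exact mem_biUnion hx hyx

/-- **Lemma.** Let `M` carry a chronology `≪` and the Alexandrov topology. If `P` is an IP
which is the past of a future-directed chain and `P'` is a past set with `P' ⊊ P`, then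
`P \ cl(P')` is non-empty. -/
theorem diff_closure_nonempty_of_ssubset
    (r : M → M → Prop) (hr : IsChronology r)
    (p : ℕ → M) (hchain : ∀ n, r (p n) (p (n + 1)))
    (P : Set M) (hP : IsIP r P) (hPgen : P = IPastS r (Set.range p))
    (P' : Set M) (hP' : IsPastSet r P') (hss : P' ⊂ P) :
    (P \ @closure M (alexTop r) P').Nonempty := by
  obtain ⟨q, hqP, hqP'⟩ := exists_of_ssubset hss
  rw [hPgen] at hqP
  obtain ⟨_, ⟨n, rfl⟩, hqn⟩ := mem_iUnion₂.1 hqP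
  have hpn : p n ∉ P' := fun h => hqP' (hP'.mem_of_rel h hqn)
  refine ⟨p (n + 1), ?_, fun hcl => ?_⟩
  · rw [hPgen]
    exact mem_biUnion (mem_range_self (n + 2)) (hchain (n + 1))
  · let := alexTop r
    have hopen : IsOpen (IFut r (p n) ∩ IPast r (p (n + 2))) :=
      TopologicalSpace.isOpen_generateFrom_of_mem ⟨_, _, rfl⟩
    obtain ⟨x, ⟨hx, -⟩, hxP'⟩ := mem_closure_iff.1 hcl _ hopen ⟨hchain n, hchain (n + 1)⟩
    exact hpn (hP'.mem_of_rel hxP' hx)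
end
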